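/- There do not exist a real number λ > 0 and families of 2×2 real matrices A, B, C, D : Fin 2 → Matrix (Fin 2) (Fin 2) ℝ with all entries nonnegative such that for all i, j, k, l ∈ Fin 2, trace(A i * B j * C k * D l) = λ * (if i = k then 1 else 0) * (if j = l then 1 else 0). (Crossed communication of two bits over a square classical network with binary channels is impossible even by stochastic classical network coding.) -/

import Mathlib

open Matrix

/-- Among closed walks `x i j → y i j → z i j → t i j → x i j` in the binary square network, one
for each pair `(i, j)`, some four edges with labels `i, j, k, l` such that `(i, j) ≠ (k, l)`
compose to a closed walk. -/
lemma exists_crossed_closed_walk (x y z t : Fin 2 → Fin 2 → Fin 2) :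
    ∃ i j k l a b c d : Fin 2, ¬ (i = k ∧ j = l) ∧
      y i a = y b j ∧ z b j = z k c ∧ t k c = t d l ∧ x d l = x i a := by
  by_contra! h
  have h1 := h 1 0 0 0 1 0 0 0 (by decide)
  have h2 := h 0 1 0 0 1 0 0 0 (by decide)
  have h3 := h 1 1 0 1 1 0 1 0 (by decide)
  have h4 := h 0 0 0 1 1 0 0 0 (by decide)
  have h5 := h 0 0 1 1 1 1 0 0 (by decide)
  have h6 := h 0 0 1 0 0 1 0 0 (by decide)
  have h7 := h 1 1 1 0 0 1 0 1 (by decide)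
  have h8 := h 0 1 1 0 1 0 0 1 (by decide)
  have h9 := h 1 0 0 0 0 1 0 0 (by decide)
  have h10 := h 1 1 1 0 1 1 1 1 (by decide)
  have h11 := h 0 1 1 1 1 0 1 0 (by decide)
  have h12 := h 1 1 0 1 1 1 0 1 (by decide)
  have h13 := h 1 0 1 1 1 0 1 1 (by decide)
  have h14 := h 0 0 0 1 0 0 0 1 (by decide)
  have h15 := h 0 0 1 1 1 1 1 1 (by decide)
  have h16 := h 1 1 0 0 1 1 1 1 (by decide)
  have h17 := h 1 0 0 1 1 1 1 1 (by decide)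
  have h18 := h 0 1 1 0 1 1 1 1 (by decide)
  clear h
  grind (splits := 40)

/-- A trace of a product of four nonnegative `2 × 2` matrices is at least any of its terms. -/
lemma term_le_trace_mul_mul_mul {M N P Q : Matrix (Fin 2) (Fin 2) ℝ}
    (hM : ∀ x y, 0 ≤ M x y) (hN : ∀ x y, 0 ≤ N x y) (hP : ∀ x y, 0 ≤ P x y)
    (hQ : ∀ x y, 0 ≤ Q x y) (x y z t : Fin 2) :
    M x y * N y z * P z t * Q t x ≤ (M * N * P * Q).trace := by
  have key : ∀ a b c d, 0 ≤ M a b * N b c * P c d * Q d a := fun a b c d =>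
    mul_nonneg (mul_nonneg (mul_nonneg (hM _ _) (hN _ _)) (hP _ _)) (hQ _ _)
  simp only [Matrix.trace, Matrix.diag, Matrix.mul_apply, Finset.sum_mul]
  calc M x y * N y z * P z t * Q t x
      ≤ ∑ b, M x b * N b z * P z t * Q t x :=
        Finset.single_le_sum (f := fun b => M x b * N b z * P z t * Q t x)
          (fun b _ => key x b z t) (Finset.mem_univ y)
    _ ≤ ∑ c, ∑ b, M x b * N b c * P c t * Q t x :=
        Finset.single_le_sum (f := fun c => ∑ b, M x b * N b c * P c t * Q t x)
          (fun c _ => Finset.sum_nonneg fun b _ => key x b c t) (Finset.mem_univ z)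
    _ ≤ ∑ d, ∑ c, ∑ b, M x b * N b c * P c d * Q d x :=
        Finset.single_le_sum (f := fun d => ∑ c, ∑ b, M x b * N b c * P c d * Q d x)
          (fun d _ => Finset.sum_nonneg fun c _ => Finset.sum_nonneg fun b _ => key x b c d)
          (Finset.mem_univ t)
    _ ≤ _ :=
        Finset.single_le_sum (f := fun a => ∑ d, ∑ c, ∑ b, M a b * N b c * P c d * Q d a)
          (fun a _ => Finset.sum_nonneg fun d _ => Finset.sum_nonneg fun c _ =>
            Finset.sum_nonneg fun b _ => key a b c d) (Finset.mem_univ x)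

/-- A product of four nonnegative matrices with positive trace has a closed walk of positive
entries. -/
lemma exists_pos_closed_walk {M N P Q : Matrix (Fin 2) (Fin 2) ℝ}
    (hM : ∀ x y, 0 ≤ M x y) (hN : ∀ x y, 0 ≤ N x y) (hP : ∀ x y, 0 ≤ P x y)
    (hQ : ∀ x y, 0 ≤ Q x y) (h : 0 < (M * N * P * Q).trace) :
    ∃ x y z t, 0 < M x y ∧ 0 < N y z ∧ 0 < P z t ∧ 0 < Q t x := by
  simp only [Matrix.trace, Matrix.diag, Matrix.mul_apply, Finset.sum_mul] at h
  obtain ⟨x, -, hx⟩ := Finset.exists_ne_zero_of_sum_ne_zero h.ne'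
  obtain ⟨t, -, ht⟩ := Finset.exists_ne_zero_of_sum_ne_zero hx
  obtain ⟨z, -, hz⟩ := Finset.exists_ne_zero_of_sum_ne_zero ht
  obtain ⟨y, -, hy⟩ := Finset.exists_ne_zero_of_sum_ne_zero hz
  simp only [ne_eq, mul_eq_zero, not_or] at hy
  obtain ⟨⟨⟨h1, h2⟩, h3⟩, h4⟩ := hy
  exact ⟨x, y, z, t, (hM _ _).lt_of_ne' h1, (hN _ _).lt_of_ne' h2, (hP _ _).lt_of_ne' h3,
    (hQ _ _).lt_of_ne' h4⟩

/-- Crossed communication of two bits over a square classical network with binary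
channels is impossible even by stochastic classical network coding: there is no
nonnegative square-network solution of dimension 2 with any positive scale `λ`. -/
theorem no_nonneg_square_network_solution_dim_two :
    ¬ ∃ (lam : ℝ) (A B C D : Fin 2 → Matrix (Fin 2) (Fin 2) ℝ),
      0 < lam ∧
      (∀ i : Fin 2, ∀ x y : Fin 2, 0 ≤ A i x y) ∧
      (∀ i : Fin 2, ∀ x y : Fin 2, 0 ≤ B i x y) ∧
      (∀ i : Fin 2, ∀ x y : Fin 2, 0 ≤ C i x y) ∧
      (∀ i : Fin 2, ∀ x y : Fin 2, 0 ≤ D i x y) ∧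
      (∀ i j k l : Fin 2,
        (A i * B j * C k * D l).trace =
          lam * (if i = k then 1 else 0) * (if j = l then 1 else 0)) := by
  rintro ⟨lam, A, B, C, D, hlam, hA, hB, hC, hD, h⟩
  have hwalk : ∀ i j, ∃ x y z t, 0 < A i x y ∧ 0 < B j y z ∧ 0 < C i z t ∧ 0 < D j t x :=
    fun i j => exists_pos_closed_walk (hA i) (hB j) (hC i) (hD j) (by simpa [h] using hlam)
  choose x y z t hxy hyz hzt htx using hwalk
  obtain ⟨i, j, k, l, a, b, c, d, hne, hy, hz, ht, hx⟩ := exists_crossed_closed_walk x y z t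
  have hle := term_le_trace_mul_mul_mul (hA i) (hB j) (hC k) (hD l)
    (x i a) (y i a) (z b j) (t k c)
  have hBpos : 0 < B j (y i a) (z b j) := hy ▸ hyz b j
  have hCpos : 0 < C k (z b j) (t k c) := hz ▸ hzt k c
  have hDpos : 0 < D l (t k c) (x i a) := ht ▸ hx ▸ htx d l
  have hpos := mul_pos (mul_pos (mul_pos (hxy i a) hBpos) hCpos) hDpos
  have hzero : (A i * B j * C k * D l).trace = 0 := by
    rw [h]
    by_cases hik : i = k
    · have hjl : j ≠ l := fun hjl => hne ⟨hik, hjl⟩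
      simp [hjl]
    · simp [hik]
  linarith
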